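/- Let P₁, P₂, P₃, P₄ and N₁, N₂, N₃, N₄ be positive real numbers, and set R_outer = min{ C(P₁/N₂), C(P₂/N₃), C(P₃/N₄), C(P₄/N₃), C(P₃/N₂), C(P₂/N₁) }. Then there exist positive reals P₁′ ≤ P₁, P₂′ ≤ P₂, P₃′ ≤ P₃, P₄′ ≤ P₄ and positive integers N, M such that P₁′/P₃′ equals N² or 1/N², P₂′/P₄′ equals M² or 1/M², and min{ [½·log₂(P₁′/N₂)]⁺, [½·log₂(P₂′/N₃)]⁺, [½·log₂(P₃′/N₄)]⁺, [½·log₂(P₄′/N₃)]⁺, [½·log₂(P₃′/N₂)]⁺, [½·log₂(P₂′/N₁)]⁺ } + ½·log₂ 3 ≥ R_outer. In particular, the truncated-power rate expression of Theorem 3 is within ½·log₂ 3 of the outer bound R_outer. -/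

import Mathlib

/-- Two powers can be truncated so that their ratio is a perfect square, losing at most a factor
of two in the second power and in the smaller of the two. -/
lemma exists_truncation_ratio_eq_sq {a b : ℝ} (ha : 0 < a) (hb : 0 < b) :
    ∃ (a' b' : ℝ) (n : ℕ), 0 < n ∧ 0 < a' ∧ a' ≤ a ∧ 0 < b' ∧ b' ≤ b ∧
      b' / a' = (n : ℝ) ^ 2 ∧ min a b / 2 ≤ a' ∧ b / 2 ≤ b' := by
  rcases le_or_gt b a with hba | hab
  · refine ⟨b, b, 1, one_pos, hb, hba, hb, le_rfl, by simp [hb.ne'], ?_, by linarith⟩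
    rw [min_eq_right hba]
    linarith
  · rw [min_eq_left hab.le]
    set k := ⌊√(b / a)⌋₊
    have hk_one : 1 ≤ k := by
      refine Nat.le_floor ?_
      rw [Nat.cast_one, Real.one_le_sqrt, one_le_div ha]
      exact hab.le
    have hk_cast : (1 : ℝ) ≤ k := by exact_mod_cast hk_one
    have hk_lower : (k : ℝ) ^ 2 * a ≤ b := by
      rw [← le_div_iff₀ ha]
      exact (Real.le_sqrt' (by linarith)).1 (Nat.floor_le (Real.sqrt_nonneg _))
    have hk_upper : b < ((k : ℝ) + 1) ^ 2 * a := by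
      rw [← div_lt_iff₀ ha]
      exact (Real.sqrt_lt' (by linarith)).1 (Nat.lt_floor_add_one _)
    rcases le_or_gt b (2 * ((k : ℝ) ^ 2 * a)) with h | h
    · exact ⟨a, k ^ 2 * a, k, hk_one, ha, le_rfl, by positivity, hk_lower,
        by field_simp, by linarith, by linarith⟩
    · refine ⟨b / (k + 1) ^ 2, b, k + 1, k.succ_pos, by positivity, ?_, hb, le_rfl, ?_, ?_,
        by linarith⟩
      · rw [div_le_iff₀ (by positivity)]
        linarith
      · push_cast
        field_simp
      · rw [le_div_iff₀ (by positivity)]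
        nlinarith [mul_nonneg ha.le (mul_nonneg (sub_nonneg.2 hk_cast)
          (by linarith : (0 : ℝ) ≤ 3 * k + 1))]

/-- Halving the signal-to-noise ratio and dropping the `1 +` costs at most `½ log₂ 3`. -/
lemma half_logb_one_add_le {x y : ℝ} (hy : 0 < y) (hyx : y / 2 ≤ x) :
    (1 / 2) * Real.logb 2 (1 + y) ≤
      max ((1 / 2) * Real.logb 2 x) 0 + (1 / 2) * Real.logb 2 3 := by
  have hx : 0 < x := by linarith
  rcases le_or_gt y 2 with h | h
  · have hlog : Real.logb 2 (1 + y) ≤ Real.logb 2 3 :=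
      Real.logb_le_logb_of_le one_lt_two (by linarith) (by linarith)
    linarith [le_max_right ((1 / 2) * Real.logb 2 x) 0]
  · have hlog : Real.logb 2 (1 + y) ≤ Real.logb 2 (x * 3) :=
      Real.logb_le_logb_of_le one_lt_two (by linarith) (by linarith)
    rw [Real.logb_mul hx.ne' three_ne_zero] at hlog
    linarith [le_max_left ((1 / 2) * Real.logb 2 x) 0]

/-- The rate loss bound for a transmit power `p'` at least half of the power `p`, at noise `N`. -/
lemma half_logb_one_add_div_le {p p' N : ℝ} (hp : 0 < p) (hN : 0 < N) (h : p / 2 ≤ p') :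
    (1 / 2) * Real.logb 2 (1 + p / N) ≤
      max ((1 / 2) * Real.logb 2 (p' / N)) 0 + (1 / 2) * Real.logb 2 3 := by
  refine half_logb_one_add_le (div_pos hp hN) ?_
  rw [div_right_comm]
  gcongr

/-- The rate loss bound for a transmit power `p'` at least half of the smaller of two powers. -/
lemma min_half_logb_one_add_div_le {p q p' N : ℝ} (hp : 0 < p) (hq : 0 < q) (hN : 0 < N)
    (h : min p q / 2 ≤ p') :
    min ((1 / 2) * Real.logb 2 (1 + p / N)) ((1 / 2) * Real.logb 2 (1 + q / N)) ≤
      max ((1 / 2) * Real.logb 2 (p' / N)) 0 + (1 / 2) * Real.logb 2 3 := by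
  rcases min_choice p q with hm | hm <;> rw [hm] at h
  · exact (min_le_left _ _).trans (half_logb_one_add_div_le hp hN h)
  · exact (min_le_right _ _).trans (half_logb_one_add_div_le hq hN h)

/-- Constant-gap claim of Theorem 3 of the paper: the truncated-power achievable
symmetric rate is within `½ log₂ 3` of the cut-set style outer bound `R_outer`. -/
theorem truncated_power_rate_within_half_log_three_of_outer_bound
    (P₁ P₂ P₃ P₄ N₁ N₂ N₃ N₄ : ℝ)
    (hP₁ : 0 < P₁) (hP₂ : 0 < P₂) (hP₃ : 0 < P₃) (hP₄ : 0 < P₄)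
    (hN₁ : 0 < N₁) (hN₂ : 0 < N₂) (hN₃ : 0 < N₃) (hN₄ : 0 < N₄) :
    ∃ (P₁' P₂' P₃' P₄' : ℝ) (N M : ℕ),
      0 < N ∧ 0 < M ∧
      0 < P₁' ∧ P₁' ≤ P₁ ∧ 0 < P₂' ∧ P₂' ≤ P₂ ∧
      0 < P₃' ∧ P₃' ≤ P₃ ∧ 0 < P₄' ∧ P₄' ≤ P₄ ∧
      (P₁' / P₃' = (N : ℝ) ^ 2 ∨ P₁' / P₃' = 1 / (N : ℝ) ^ 2) ∧
      (P₂' / P₄' = (M : ℝ) ^ 2 ∨ P₂' / P₄' = 1 / (M : ℝ) ^ 2) ∧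
      min (max ((1 / 2) * Real.logb 2 (P₁' / N₂)) 0)
        (min (max ((1 / 2) * Real.logb 2 (P₂' / N₃)) 0)
          (min (max ((1 / 2) * Real.logb 2 (P₃' / N₄)) 0)
            (min (max ((1 / 2) * Real.logb 2 (P₄' / N₃)) 0)
              (min (max ((1 / 2) * Real.logb 2 (P₃' / N₂)) 0)
                (max ((1 / 2) * Real.logb 2 (P₂' / N₁)) 0)))))
        + (1 / 2) * Real.logb 2 3
      ≥ min ((1 / 2) * Real.logb 2 (1 + P₁ / N₂))
          (min ((1 / 2) * Real.logb 2 (1 + P₂ / N₃))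
            (min ((1 / 2) * Real.logb 2 (1 + P₃ / N₄))
              (min ((1 / 2) * Real.logb 2 (1 + P₄ / N₃))
                (min ((1 / 2) * Real.logb 2 (1 + P₃ / N₂))
                  ((1 / 2) * Real.logb 2 (1 + P₂ / N₁)))))) := by
  obtain ⟨P₁', P₃', N, hN, hP₁', hle₁, hP₃', hle₃, hratio₁, hhalf₁, hhalf₃⟩ :=
    exists_truncation_ratio_eq_sq hP₁ hP₃
  obtain ⟨P₄', P₂', M, hM, hP₄', hle₄, hP₂', hle₂, hratio₂, hhalf₄, hhalf₂⟩ :=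
    exists_truncation_ratio_eq_sq hP₄ hP₂
  refine ⟨P₁', P₂', P₃', P₄', N, M, hN, hM, hP₁', hle₁, hP₂', hle₂, hP₃', hle₃, hP₄', hle₄,
    Or.inr ?_, Or.inl hratio₂, ?_⟩
  · rw [← hratio₁, one_div_div]
  · simp only [ge_iff_le, ← min_add_add_right]
    refine le_min ?_ (le_min ?_ (le_min ?_ (le_min ?_ (le_min ?_ ?_))))
    · refine le_trans ?_ (min_half_logb_one_add_div_le hP₁ hP₃ hN₂ hhalf₁)
      simp only [le_min_iff, min_le_iff, le_refl, true_or, or_true, and_self]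
    · refine le_trans ?_ (half_logb_one_add_div_le hP₂ hN₃ hhalf₂)
      simp only [min_le_iff, le_refl, true_or, or_true]
    · refine le_trans ?_ (half_logb_one_add_div_le hP₃ hN₄ hhalf₃)
      simp only [min_le_iff, le_refl, true_or, or_true]
    · refine le_trans ?_ (min_half_logb_one_add_div_le hP₄ hP₂ hN₃ hhalf₄)
      simp only [le_min_iff, min_le_iff, le_refl, true_or, or_true, and_self]
    · refine le_trans ?_ (half_logb_one_add_div_le hP₃ hN₂ hhalf₃)
      simp only [min_le_iff, le_refl, true_or, or_true]
    · refine le_trans ?_ (half_logb_one_add_div_le hP₂ hN₁ hhalf₂)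
      simp only [min_le_iff, le_refl, or_true]
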